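/- arXiv:2510.14399 — 2 statements merged into one kernel-verified Lean document; each statement's English description precedes it below -/
import Mathlib

section
/- Let m < ω and let α, γ be ordinals. If α =_NF φ_{α_1}(α_2) (i.e. α = φ_{α_1}(α_2) with α_1, α_2 < α), then α ∈ B_m(γ) if and only if both α_1 ∈ B_m(γ) and α_2 ∈ B_m(γ). -/
open Ordinal Set

/-- The Veblen hierarchy: `phi 0` is the strictly increasing enumeration of the
additively principal ordinals (nonzero ordinals closed under addition), and for `α > 0`,
`phi α` is the strictly increasing enumeration of the common fixed points of the
functions `phi δ` for `δ < α`. -/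
noncomputable def phi : Ordinal → Ordinal → Ordinal
  | α => Ordinal.enumOrd {β | (α = 0 → β ≠ 0 ∧ ∀ γ < β, ∀ δ < β, γ + δ < β) ∧
      ∀ δ, δ < α → phi δ β = β}
termination_by α => α
decreasing_by assumption

/-- `Cr 0` is the class of additively principal ordinals (nonzero ordinals `β` such that
`γ + δ < β` for all `γ, δ < β`); for `α > 0`, `Cr α = {β | ∀ δ < α, phi δ β = β}`.
`phi α` is (definitionally) the strictly increasing enumeration of `Cr α`. -/
def Cr (α : Ordinal) : Set Ordinal :=
  {β | (α = 0 → β ≠ 0 ∧ ∀ γ < β, ∀ δ < β, γ + δ < β) ∧ ∀ δ, δ < α → phi δ β = β}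

/-- An ordinal is strongly critical if it is nonzero and closed under `(δ, γ) ↦ phi δ γ`. -/
def StronglyCritical (α : Ordinal) : Prop :=
  α ≠ 0 ∧ ∀ δ < α, ∀ γ < α, phi δ γ < α

/-- `Gamma β` is the `β`-th strongly critical ordinal. -/
noncomputable def Gamma : Ordinal → Ordinal :=
  Ordinal.enumOrd {α | StronglyCritical α}

/-- An ordinal which is (the initial ordinal of) an uncountable regular cardinal. -/
def IsUncountableRegular (o : Ordinal) : Prop :=
  ∃ κ : Cardinal, Cardinal.aleph0 < κ ∧ κ.IsRegular ∧ o = κ.ord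

/-- The base sets `B_n^0(α)` (they do not depend on `α`):
`B_0^0(α) = {0} ∪ {Γ_β : β ≤ θ} ∪ {Ω_m : m ≤ ω}` and
`B_{n+1}^0(α) = {β : β < Ω_n} ∪ {Ω_m : m ≤ ω}`. -/
def Bbase (θ : Ordinal) (Ω : ℕ → Ordinal) (Ωω : Ordinal) : ℕ → Set Ordinal
  | 0 => {0} ∪ {x | ∃ β ≤ θ, x = Gamma β} ∪ {x | (∃ m : ℕ, x = Ω m) ∨ x = Ωω}
  | n + 1 => {β | β < Ω n} ∪ {x | (∃ m : ℕ, x = Ω m) ∨ x = Ωω}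

/-- One closure step, producing `B_n^{k+1}(α)` from `S = B_n^k(α)`, where the function `f`
plays the role of `ψ`:
`S ∪ {δ + δ' : δ, δ' ∈ S} ∪ {phi δ δ' : δ, δ' ∈ S} ∪ {f m δ : m < ω, δ ∈ S, δ < α}`. -/
def Bstep (f : ℕ → Ordinal → Ordinal) (α : Ordinal) (S : Set Ordinal) : Set Ordinal :=
  S ∪ {x | ∃ δ ∈ S, ∃ δ' ∈ S, x = δ + δ'}
    ∪ {x | ∃ δ ∈ S, ∃ δ' ∈ S, x = phi δ δ'}
    ∪ {x | ∃ m : ℕ, ∃ δ ∈ S, δ < α ∧ x = f m δ}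

/-- The sets `B_n^k(α)`, where the function `f` plays the role of `ψ`. -/
def Biter (θ : Ordinal) (Ω : ℕ → Ordinal) (Ωω : Ordinal)
    (f : ℕ → Ordinal → Ordinal) (α : Ordinal) (n : ℕ) : ℕ → Set Ordinal
  | 0 => Bbase θ Ω Ωω n
  | k + 1 => Bstep f α (Biter θ Ω Ωω f α n k)

/-- `psi θ Ω Ωω n α` is the least ordinal not in `B_n(α) = ⋃ k, B_n^k(α)`.  (The values of
`ψ` are only ever used at arguments `δ < α`, so the guard `if δ < α` does not change the
sets `B_n^k(α)`; it only serves to make the recursion on `α` well-founded.) -/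
noncomputable def psi (θ : Ordinal) (Ω : ℕ → Ordinal) (Ωω : Ordinal) : ℕ → Ordinal → Ordinal
  | n, α => sInf {β | β ∉ ⋃ k,
      Biter θ Ω Ωω (fun m δ => if _ : δ < α then psi θ Ω Ωω m δ else 0) α n k}
termination_by n α => α
decreasing_by assumption

/-- The set `B_n(α) = ⋃ k, B_n^k(α)`. -/
noncomputable def Bset (θ : Ordinal) (Ω : ℕ → Ordinal) (Ωω : Ordinal)
    (n : ℕ) (α : Ordinal) : Set Ordinal :=
  ⋃ k, Biter θ Ω Ωω (fun m δ => if _ : δ < α then psi θ Ω Ωω m δ else 0) α n k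

universe u

theorem enumOrd_mem_or_eq_zero (s : Set Ordinal) (o : Ordinal) :
    Ordinal.enumOrd s o ∈ s ∨ Ordinal.enumOrd s o = 0 := by
  rw [Ordinal.enumOrd]
  rcases (s ∩ {b | ∀ c, c < o → Ordinal.enumOrd s c < b}).eq_empty_or_nonempty with h | h
  · exact Or.inr (by rw [h, Ordinal.sInf_empty])
  · exact Or.inl (csInf_mem h).1

theorem phi_eq_enumOrd_Cr (α : Ordinal) : phi α = Ordinal.enumOrd (Cr α) := by
  rw [phi]
  rfl

theorem phi_eq_veblen (α : Ordinal) : phi α = veblen α := by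
  induction α using WellFoundedLT.induction with
  | ind α ih =>
    have hCr : Cr α = range (veblen α) := by
      ext β
      rcases eq_or_ne α 0 with rfl | hα
      · have h := isPrincipal_add_iff_zero_or_omega0_opow (o := β)
        have hpos : β ∈ range (ω ^ · : Ordinal → Ordinal) → β ≠ 0 := by
          rintro ⟨x, rfl⟩
          exact (opow_pos x omega0_pos).ne'
        rw [veblen_zero]
        constructor
        · rintro ⟨h₀, -⟩
          obtain ⟨hβ, hadd⟩ := h₀ rfl
          exact (h.1 fun a b ha hb => hadd a ha b hb).resolve_left hβ
        · intro hβ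
          exact ⟨fun _ => ⟨hpos hβ, fun a ha b hb => h.2 (Or.inr hβ) ha hb⟩,
            fun δ hδ => absurd hδ (not_lt_bot (a := δ))⟩
      · rw [mem_range_veblen hα]
        constructor
        · intro h δ hδ
          rw [← ih δ hδ]
          exact h.2 δ hδ
        · intro h
          exact ⟨fun h₀ => absurd h₀ hα, fun δ hδ => by rw [ih δ hδ]; exact h δ hδ⟩
    rw [phi_eq_enumOrd_Cr, hCr, enumOrd_range (veblen_right_strictMono α)]

theorem veblen_eq_derivFamily_toType {o : Ordinal} (ho : o ≠ 0) :
    veblen o = derivFamily fun i : o.ToType => veblen (Ordinal.ToType.mk.symm i).1 := by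
  rw [veblen_of_ne_zero ho, derivFamily_eq_enumOrd fun _ => isNormal_veblen _,
    derivFamily_eq_enumOrd fun _ => isNormal_veblen _]
  congr 1
  exact (Ordinal.ToType.mk.symm.surjective.iInter_comp
    fun x : Iio o => Function.fixedPoints (veblen x.1)).symm

theorem veblen_lt_ord {c : Cardinal} (hc : c.IsRegular) (hc' : Cardinal.aleph0 < c)
    {o a : Ordinal} (ho : o < c.ord) (ha : a < c.ord) : veblen o a < c.ord := by
  induction o using WellFoundedLT.induction generalizing a with
  | ind o ih =>
    rcases eq_or_ne o 0 with rfl | ho₀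
    · rw [veblen_zero]
      exact isPrincipal_opow_ord hc'.le
        (by rwa [← Cardinal.ord_aleph0, Cardinal.ord_lt_ord]) ha
    · rw [veblen_eq_derivFamily_toType ho₀]
      refine Cardinal.derivFamily_lt_ord hc ?_ hc'.ne' (fun i b hb => ?_) ha
      · rw [Cardinal.mk_toType]
        exact Cardinal.lt_ord.1 ho
      · exact ih _ (Ordinal.ToType.mk.symm i).2 ((Ordinal.ToType.mk.symm i).2.trans ho) hb

theorem IsUncountableRegular.stronglyCritical {o : Ordinal} (h : IsUncountableRegular o) :
    StronglyCritical o := by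
  obtain ⟨κ, hκ, hreg, rfl⟩ := h
  refine ⟨fun h => ?_, fun δ hδ γ hγ => ?_⟩
  · rw [Cardinal.ord_eq_zero] at h
    exact hreg.ne_zero h
  · rw [phi_eq_veblen]
    exact veblen_lt_ord hreg hκ hδ hγ

theorem not_stronglyCritical_phi {a b : Ordinal} (ha : a < phi a b) (hb : b < phi a b) :
    ¬ StronglyCritical (phi a b) :=
  fun h => (h.2 a ha b hb).false

theorem phi_ne_zero (a b : Ordinal.{u}) : phi a b ≠ 0 := by
  rw [phi_eq_veblen]
  exact veblen_pos.ne'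

theorem isPrincipal_add_phi (a b : Ordinal.{u}) : IsPrincipal (· + ·) (phi a b) := by
  rw [phi_eq_veblen]
  exact isPrincipal_add_iff_zero_or_omega0_opow.2 (Or.inr (veblen_mem_range_opow a b))

section

variable {θ : Ordinal} {Ω : ℕ → Ordinal} {Ωω : Ordinal}

theorem Biter_monotone (f : ℕ → Ordinal → Ordinal) (α : Ordinal) (n : ℕ) :
    Monotone (Biter θ Ω Ωω f α n) :=
  monotone_nat_of_le_succ fun _ _ hx => Or.inl (Or.inl (Or.inl hx))

theorem phi_mem_Bset {n : ℕ} {α a b : Ordinal} (ha : a ∈ Bset θ Ω Ωω n α)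
    (hb : b ∈ Bset θ Ω Ωω n α) : phi a b ∈ Bset θ Ω Ωω n α := by
  obtain ⟨i, hi⟩ := mem_iUnion.1 ha
  obtain ⟨j, hj⟩ := mem_iUnion.1 hb
  exact mem_iUnion.2 ⟨max i j + 1, Or.inl (Or.inr
    ⟨a, Biter_monotone _ _ _ (le_max_left i j) hi, b,
      Biter_monotone _ _ _ (le_max_right i j) hj, rfl⟩)⟩

theorem psi_eq_sInf (n : ℕ) (α : Ordinal) :
    psi θ Ω Ωω n α = sInf {β | β ∉ Bset θ Ω Ωω n α} := by
  rw [psi]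
  rfl

/-- `psi n α` is not the value of `phi` at smaller arguments: it is the least ordinal outside a
set closed under `phi`. -/
theorem psi_ne_phi {n : ℕ} {α a b : Ordinal} (ha : a < phi a b) (hb : b < phi a b) :
    phi a b ≠ psi θ Ω Ωω n α := by
  rw [psi_eq_sInf]
  intro h
  have hmem : ∀ x < phi a b, x ∈ Bset θ Ω Ωω n α := fun x hx => by
    rw [h] at hx
    exact not_not.1 (notMem_of_lt_csInf' hx)
  rcases {β | β ∉ Bset θ Ω Ωω n α}.eq_empty_or_nonempty with he | hne
  · exact phi_ne_zero a b (by rw [h, he, Ordinal.sInf_empty])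
  · have := csInf_mem hne
    rw [← h] at this
    exact this (phi_mem_Bset (hmem a ha) (hmem b hb))

theorem mem_Bbase_of_phi_mem_Bbase (hΩ : ∀ n : ℕ, StronglyCritical (Ω n))
    (hΩω : StronglyCritical Ωω) {n : ℕ} {a b : Ordinal} (ha : a < phi a b) (hb : b < phi a b)
    (h : phi a b ∈ Bbase θ Ω Ωω n) : a ∈ Bbase θ Ω Ωω n ∧ b ∈ Bbase θ Ω Ωω n := by
  have hsc := not_stronglyCritical_phi ha hb
  have hcard : ¬ ((∃ m : ℕ, phi a b = Ω m) ∨ phi a b = Ωω) := by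
    rintro (⟨m, h⟩ | h)
    · exact hsc (h ▸ hΩ m)
    · exact hsc (h ▸ hΩω)
  cases n with
  | zero =>
    rcases h with (h | ⟨β, -, h⟩) | h
    · exact absurd h (phi_ne_zero a b)
    · rcases enumOrd_mem_or_eq_zero {α | StronglyCritical α} β with hβ | hβ
      · exact absurd (h ▸ hβ) hsc
      · exact absurd (h.trans hβ) (phi_ne_zero a b)
    · exact absurd h hcard
  | succ n =>
    rcases h with h | h
    · exact ⟨Or.inl (ha.trans h), Or.inl (hb.trans h)⟩
    · exact absurd h hcard

theorem mem_Bset_of_phi_mem_Bset (hΩ : ∀ n : ℕ, StronglyCritical (Ω n))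
    (hΩω : StronglyCritical Ωω) {n : ℕ} {γ a b : Ordinal} (ha : a < phi a b) (hb : b < phi a b)
    (h : phi a b ∈ Bset θ Ω Ωω n γ) : a ∈ Bset θ Ω Ωω n γ ∧ b ∈ Bset θ Ω Ωω n γ := by
  obtain ⟨k, hk⟩ := mem_iUnion.1 h
  clear h
  induction k with
  | zero =>
    obtain ⟨h₁, h₂⟩ := mem_Bbase_of_phi_mem_Bbase hΩ hΩω ha hb hk
    exact ⟨mem_iUnion.2 ⟨0, h₁⟩, mem_iUnion.2 ⟨0, h₂⟩⟩
  | succ k ih =>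
    rcases hk with ((hk | ⟨δ, hδ, δ', hδ', h⟩) | ⟨δ, hδ, δ', hδ', h⟩) | ⟨m, δ, hδ, hδγ, h⟩
    · exact ih hk
    · have hle : δ ≤ phi a b := h ▸ le_self_add
      have hle' : δ' ≤ phi a b := h ▸ le_add_self
      rcases hle.eq_or_lt with rfl | hlt
      · exact ih hδ
      rcases hle'.eq_or_lt with rfl | hlt'
      · exact ih hδ'
      exact absurd h (isPrincipal_add_phi a b hlt hlt').ne'
    · have h' := h
      rw [phi_eq_veblen, phi_eq_veblen, veblen_eq_veblen_iff] at h'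
      rcases h' with ⟨rfl, rfl⟩ | ⟨-, hb'⟩ | ⟨-, hδ''⟩
      · exact ⟨mem_iUnion.2 ⟨k, hδ⟩, mem_iUnion.2 ⟨k, hδ'⟩⟩
      · rw [← phi_eq_veblen, ← h] at hb'
        exact absurd hb' hb.ne
      · rw [← phi_eq_veblen] at hδ''
        exact ih (hδ'' ▸ hδ')
    · replace h := h.trans (dif_pos hδγ)
      exact absurd h (psi_ne_phi ha hb)

end

/-- If `α =_NF phi α₁ α₂` (that is: `α = phi α₁ α₂` with `α₁, α₂ < α`), then
`α ∈ B_m(γ)` if and only if `α₁ ∈ B_m(γ)` and `α₂ ∈ B_m(γ)`. -/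
theorem Bset_mem_phi_NF (θ : Ordinal) (Ω : ℕ → Ordinal) (Ωω : Ordinal)
    (hΩreg : ∀ n : ℕ, IsUncountableRegular (Ω n)) (hΩωreg : IsUncountableRegular Ωω)
    (hΩmono : ∀ n : ℕ, Ω n < Ω (n + 1)) (hΩltω : ∀ n : ℕ, Ω n < Ωω)
    (hθ : θ < Ω 0)
    (m : ℕ) (α γ α₁ α₂ : Ordinal)
    (hNF : α = phi α₁ α₂) (h₁ : α₁ < α) (h₂ : α₂ < α) :
    α ∈ Bset θ Ω Ωω m γ ↔ α₁ ∈ Bset θ Ω Ωω m γ ∧ α₂ ∈ Bset θ Ω Ωω m γ := by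
  subst hNF
  exact ⟨mem_Bset_of_phi_mem_Bset (fun n => (hΩreg n).stronglyCritical) hΩωreg.stronglyCritical
    h₁ h₂, fun h => phi_mem_Bset h.1 h.2⟩
end

section
/- Let m < ω and let α, γ be ordinals. If α =_NF ψ_m(α_1) (i.e. α = ψ_m(α_1) with α_1 ∈ B_m(α_1)), then α ∈ B_m(γ) if and only if α_1 ∈ B_m(γ) and α_1 < γ. -/
open Ordinal Set

universe u

theorem Biter_mono (θ : Ordinal) (Ω : ℕ → Ordinal) (Ωω : Ordinal)
    {α γ : Ordinal} (hαγ : α ≤ γ) (n k : ℕ) :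
    Biter θ Ω Ωω (fun m δ => if _ : δ < α then psi θ Ω Ωω m δ else 0) α n k ⊆
      Biter θ Ω Ωω (fun m δ => if _ : δ < γ then psi θ Ω Ωω m δ else 0) γ n k := by
  induction k with
  | zero => exact subset_rfl
  | succ k ih =>
    rintro x (((hx | ⟨δ, hδ, δ', hδ', rfl⟩) | ⟨δ, hδ, δ', hδ', rfl⟩) | ⟨m, δ, hδ, hlt, rfl⟩)
    · exact .inl (.inl (.inl (ih hx)))
    · exact .inl (.inl (.inr ⟨δ, ih hδ, δ', ih hδ', rfl⟩))
    · exact .inl (.inr ⟨δ, ih hδ, δ', ih hδ', rfl⟩)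
    · exact .inr ⟨m, δ, ih hδ, hlt.trans_le hαγ, by simp [hlt, hlt.trans_le hαγ]⟩

theorem Bset_mono (θ : Ordinal) (Ω : ℕ → Ordinal) (Ωω : Ordinal)
    {α γ : Ordinal} (hαγ : α ≤ γ) (n : ℕ) :
    Bset θ Ω Ωω n α ⊆ Bset θ Ω Ωω n γ :=
  iUnion_mono fun k => Biter_mono θ Ω Ωω hαγ n k

theorem psi_mem_Bset (θ : Ordinal) (Ω : ℕ → Ordinal) (Ωω : Ordinal) {n : ℕ} {α γ : Ordinal}
    (hα : α ∈ Bset θ Ω Ωω n γ) (hαγ : α < γ) (m : ℕ) :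
    psi θ Ω Ωω m α ∈ Bset θ Ω Ωω n γ := by
  obtain ⟨k, hk⟩ := mem_iUnion.1 hα
  exact mem_iUnion.2 ⟨k + 1, .inr ⟨m, α, hk, hαγ, by simp [hαγ]⟩⟩

theorem small_Bbase (θ : Ordinal.{u}) (Ω : ℕ → Ordinal.{u}) (Ωω : Ordinal.{u}) (n : ℕ) :
    Small.{u} (Bbase θ Ω Ωω n) := by
  have hΩ : Small.{u} ↑{x | (∃ m : ℕ, x = Ω m) ∨ x = Ωω} := by
    have hsub : {x | (∃ m : ℕ, x = Ω m) ∨ x = Ωω} ⊆ range Ω ∪ {Ωω} := by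
      rintro x (⟨m, rfl⟩ | rfl)
      · exact .inl ⟨m, rfl⟩
      · exact .inr rfl
    exact small_subset hsub
  cases n with
  | zero =>
    have hΓ : Small.{u} ↑{x | ∃ β ≤ θ, x = Gamma β} := by
      have hsub : {x | ∃ β ≤ θ, x = Gamma β} ⊆ Gamma '' Iic θ := by
        rintro x ⟨β, hβ, rfl⟩
        exact ⟨β, hβ, rfl⟩
      exact small_subset hsub
    have := small_union.{u} {0} {x | ∃ β ≤ θ, x = Gamma β}
    exact small_union.{u} _ {x | (∃ m : ℕ, x = Ω m) ∨ x = Ωω}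
  | succ n =>
    have : Small.{u} ↑{β | β < Ω n} := inferInstanceAs (Small.{u} (Iio (Ω n)))
    exact small_union.{u} {β | β < Ω n} {x | (∃ m : ℕ, x = Ω m) ∨ x = Ωω}

theorem small_Bstep (f : ℕ → Ordinal.{u} → Ordinal.{u}) (α : Ordinal.{u}) (S : Set Ordinal.{u})
    [Small.{u} S] : Small.{u} (Bstep f α S) := by
  suffices hsub : Bstep f α S ⊆ S ∪ image2 (· + ·) S S ∪ image2 phi S S ∪ ⋃ m, f m '' S from
    small_subset hsub
  rintro x (((hx | ⟨δ, hδ, δ', hδ', rfl⟩) | ⟨δ, hδ, δ', hδ', rfl⟩) | ⟨m, δ, hδ, -, rfl⟩)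
  · exact .inl (.inl (.inl hx))
  · exact .inl (.inl (.inr ⟨δ, hδ, δ', hδ', rfl⟩))
  · exact .inl (.inr ⟨δ, hδ, δ', hδ', rfl⟩)
  · exact .inr (mem_iUnion.2 ⟨m, δ, hδ, rfl⟩)

theorem small_Biter (θ : Ordinal.{u}) (Ω : ℕ → Ordinal.{u}) (Ωω : Ordinal.{u})
    (f : ℕ → Ordinal.{u} → Ordinal.{u}) (α : Ordinal.{u}) (n k : ℕ) :
    Small.{u} (Biter θ Ω Ωω f α n k) := by
  induction k with
  | zero => exact small_Bbase θ Ω Ωω n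
  | succ k ih => exact small_Bstep f α _

theorem small_Bset (θ : Ordinal.{u}) (Ω : ℕ → Ordinal.{u}) (Ωω : Ordinal.{u}) (n : ℕ)
    (α : Ordinal.{u}) : Small.{u} (Bset θ Ω Ωω n α) := by
  have := small_Biter θ Ω Ωω (fun m δ => if _ : δ < α then psi θ Ω Ωω m δ else 0) α n
  exact small_iUnion _

theorem psi_notMem_Bset (θ : Ordinal) (Ω : ℕ → Ordinal) (Ωω : Ordinal) (n : ℕ) (α : Ordinal) :
    psi θ Ω Ωω n α ∉ Bset θ Ω Ωω n α := by
  have := small_Bset θ Ω Ωω n α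
  have hne : {β | β ∉ Bset θ Ω Ωω n α}.Nonempty := by
    obtain ⟨b, hb⟩ := Ordinal.bddAbove_of_small (s := Bset θ Ω Ωω n α)
    exact ⟨Order.succ b, fun h => (Order.lt_succ b).not_ge (hb h)⟩
  rw [psi]
  exact csInf_mem hne

/-- If `α =_NF ψ_m(α₁)` (that is: `α = ψ_m(α₁)` with `α₁ ∈ B_m(α₁)`), then
`α ∈ B_m(γ)` if and only if `α₁ ∈ B_m(γ)` and `α₁ < γ`. -/
theorem Bset_mem_psi_NF (θ : Ordinal) (Ω : ℕ → Ordinal) (Ωω : Ordinal)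
    (hΩreg : ∀ n : ℕ, IsUncountableRegular (Ω n)) (hΩωreg : IsUncountableRegular Ωω)
    (hΩmono : ∀ n : ℕ, Ω n < Ω (n + 1)) (hΩltω : ∀ n : ℕ, Ω n < Ωω)
    (hθ : θ < Ω 0)
    (m : ℕ) (α γ α₁ : Ordinal)
    (hNF : α = psi θ Ω Ωω m α₁) (h₁ : α₁ ∈ Bset θ Ω Ωω m α₁) :
    α ∈ Bset θ Ω Ωω m γ ↔ α₁ ∈ Bset θ Ω Ωω m γ ∧ α₁ < γ := by
  subst hNF
  refine ⟨fun h => ?_, fun ⟨hmem, hlt⟩ => psi_mem_Bset θ Ω Ωω hmem hlt m⟩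
  have hlt : α₁ < γ := by
    by_contra! hle
    exact psi_notMem_Bset θ Ω Ωω m α₁ (Bset_mono θ Ω Ωω hle m h)
  exact ⟨Bset_mono θ Ω Ωω hlt.le m h₁, hlt⟩
end
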